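/- (Maximum sum-rate value, boundary optimum.) Assume P₁ > 0, P₂ > 0 and |h₁†h₂| ≥ √(P₁P₂) · det(H†H). Then the maximum of det(I_N + H Q_r(ρ) H†) over all ρ ∈ ℂ with |ρ| ≤ 1 equals 1 + P₁‖h₁‖² + P₂‖h₂‖² + 2√(P₁P₂) · |h₁†h₂|, and it is attained at ρ = e^{i·arg(h₁†h₂)} (with the convention e^{i·arg(0)} = 1). -/

import Mathlib

open Matrix Complex Filter

/-- The `N × 2` matrix with columns `h₁` and `h₂`. -/
noncomputable def Hm {N : ℕ} (h₁ h₂ : Fin N → ℂ) : Matrix (Fin N) (Fin 2) ℂ :=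
  Matrix.of fun i j => if j = 0 then h₁ i else h₂ i

/-- The Hermitian inner product `h₁† h₂ = ∑ i, conj (h₁ i) * h₂ i`. -/
noncomputable def ip {N : ℕ} (h₁ h₂ : Fin N → ℂ) : ℂ :=
  ∑ i, (starRingEnd ℂ) (h₁ i) * h₂ i

/-- The squared Euclidean norm `‖h‖²`. -/
noncomputable def nsq {N : ℕ} (h : Fin N → ℂ) : ℝ :=
  ∑ i, Complex.normSq (h i)

/-- `det (H† H)`, a nonnegative real number (taken via the real part). -/
noncomputable def detHH {N : ℕ} (h₁ h₂ : Fin N → ℂ) : ℝ :=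
  (((Hm h₁ h₂)ᴴ * Hm h₁ h₂).det).re

/-- The relay covariance matrix `Q_r(ρ)` with diagonal `P₁, P₂` and
off-diagonal `ρ √(P₁ P₂)`. -/
noncomputable def Qr (P₁ P₂ : ℝ) (ρ : ℂ) : Matrix (Fin 2) (Fin 2) ℂ :=
  !![(P₁ : ℂ), ρ * (Real.sqrt (P₁ * P₂) : ℂ);
     (starRingEnd ℂ) ρ * (Real.sqrt (P₁ * P₂) : ℂ), (P₂ : ℂ)]

/-- `det (I_N + H Q_r(ρ) H†)` (a real number, taken via the real part). -/
noncomputable def MACdet {N : ℕ} (h₁ h₂ : Fin N → ℂ) (P₁ P₂ : ℝ) (ρ : ℂ) : ℝ :=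
  ((1 + Hm h₁ h₂ * Qr P₁ P₂ ρ * (Hm h₁ h₂)ᴴ).det).re

theorem nsq_eq_ip_self {N : ℕ} (h : Fin N → ℂ) : (nsq h : ℂ) = ip h h := by
  simp [nsq, ip, Complex.normSq_eq_conj_mul_self]

theorem conj_ip {N : ℕ} (h₁ h₂ : Fin N → ℂ) : (starRingEnd ℂ) (ip h₁ h₂) = ip h₂ h₁ := by
  simp [ip, map_sum, mul_comm]

theorem conjTranspose_Hm_mul_Hm {N : ℕ} (h₁ h₂ : Fin N → ℂ) :
    (Hm h₁ h₂)ᴴ * Hm h₁ h₂ =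
      !![(nsq h₁ : ℂ), ip h₁ h₂; (starRingEnd ℂ) (ip h₁ h₂), (nsq h₂ : ℂ)] := by
  rw [nsq_eq_ip_self, nsq_eq_ip_self, conj_ip]
  ext i j
  fin_cases i <;> fin_cases j <;> simp [Matrix.mul_apply, Hm, ip]

theorem MACdet_eq {N : ℕ} (h₁ h₂ : Fin N → ℂ) {P₁ P₂ : ℝ} (hP : 0 ≤ P₁ * P₂) (ρ : ℂ) :
    MACdet h₁ h₂ P₁ P₂ ρ =
      1 + P₁ * nsq h₁ + P₂ * nsq h₂
        + 2 * Real.sqrt (P₁ * P₂) * (ρ * (starRingEnd ℂ) (ip h₁ h₂)).re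
        + P₁ * P₂ * (1 - ‖ρ‖ ^ 2) * detHH h₁ h₂ := by
  have hs := Real.mul_self_sqrt hP
  rw [MACdet, detHH, Matrix.mul_assoc, Matrix.det_one_add_mul_comm, Matrix.mul_assoc,
    conjTranspose_Hm_mul_Hm, Qr, Matrix.one_fin_two, ← Complex.normSq_eq_norm_sq,
    Complex.normSq_apply]
  simp [Matrix.det_fin_two]
  linear_combination -(ρ.re ^ 2 + ρ.im ^ 2) *
    (nsq h₁ * nsq h₂ - (ip h₁ h₂).re ^ 2 - (ip h₁ h₂).im ^ 2) * hs

/-- Maximum sum-rate value, boundary optimum. If `P₁, P₂ > 0` and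
`|h₁†h₂| ≥ √(P₁P₂)·det(H†H)`, then the maximum of `det (I_N + H Q_r(ρ) H†)` over
`|ρ| ≤ 1` equals `1 + P₁‖h₁‖² + P₂‖h₂‖² + 2√(P₁P₂)·|h₁†h₂|`, attained at
`ρ = e^{i·arg(h₁†h₂)}` (with `e^{i·arg 0} = 1`). -/
theorem stmt5 {N : ℕ} (hN : 0 < N) (h₁ h₂ : Fin N → ℂ) (P₁ P₂ : ℝ)
    (hP₁ : 0 < P₁) (hP₂ : 0 < P₂)
    (hge : Real.sqrt (P₁ * P₂) * detHH h₁ h₂ ≤ ‖ip h₁ h₂‖) :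
    (∀ ρ : ℂ, ‖ρ‖ ≤ 1 →
        MACdet h₁ h₂ P₁ P₂ ρ ≤
          1 + P₁ * nsq h₁ + P₂ * nsq h₂
            + 2 * Real.sqrt (P₁ * P₂) * ‖ip h₁ h₂‖) ∧
    MACdet h₁ h₂ P₁ P₂ (Complex.exp (Complex.I * ((ip h₁ h₂).arg : ℂ))) =
      1 + P₁ * nsq h₁ + P₂ * nsq h₂
        + 2 * Real.sqrt (P₁ * P₂) * ‖ip h₁ h₂‖ := by
  set s := Real.sqrt (P₁ * P₂) with hs
  have hs0 : 0 ≤ s := Real.sqrt_nonneg _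
  have hP : 0 ≤ P₁ * P₂ := (mul_pos hP₁ hP₂).le
  have hss : s * s = P₁ * P₂ := Real.mul_self_sqrt hP
  constructor
  · intro ρ hρ
    rw [MACdet_eq h₁ h₂ hP, ← hs, ← hss]
    have hre : (ρ * (starRingEnd ℂ) (ip h₁ h₂)).re ≤ ‖ρ‖ * ‖ip h₁ h₂‖ := by
      simpa using Complex.re_le_norm (ρ * (starRingEnd ℂ) (ip h₁ h₂))
    have hr : 0 ≤ 1 - ‖ρ‖ := sub_nonneg.2 hρ
    have hcross := mul_le_mul_of_nonneg_left hre hs0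
    have hdet := mul_le_mul_of_nonneg_left hge
      (mul_nonneg (mul_nonneg hs0 hr) (add_nonneg zero_le_one (norm_nonneg ρ)))
    have hgap := mul_nonneg (mul_nonneg hs0 (norm_nonneg (ip h₁ h₂))) (mul_nonneg hr hr)
    linarith
  · have hnorm : ‖Complex.exp (Complex.I * ((ip h₁ h₂).arg : ℂ))‖ = 1 := by
      rw [mul_comm, Complex.norm_exp_ofReal_mul_I]
    have hre : (Complex.exp (Complex.I * ((ip h₁ h₂).arg : ℂ)) *
        (starRingEnd ℂ) (ip h₁ h₂)).re = ‖ip h₁ h₂‖ := by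
      have hpolar := Complex.norm_mul_exp_arg_mul_I (ip h₁ h₂)
      rw [mul_comm Complex.I]
      set e := Complex.exp ((ip h₁ h₂).arg * Complex.I) with he
      have hee : e * (starRingEnd ℂ) e = 1 := by
        rw [Complex.mul_conj, Complex.normSq_eq_norm_sq, he, Complex.norm_exp_ofReal_mul_I]
        simp
      have hprod : e * (starRingEnd ℂ) (ip h₁ h₂) = (‖ip h₁ h₂‖ : ℂ) := by
        conv_lhs => rw [← hpolar]
        rw [map_mul, Complex.conj_ofReal, mul_left_comm, hee, mul_one]
      rw [hprod, Complex.ofReal_re]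
    rw [MACdet_eq h₁ h₂ hP, hnorm, hre]
    ring
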